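/- arXiv:1312.0850 — 4 statements merged into one kernel-verified Lean document; each statement's English description precedes it below -/
import Mathlib

section
/- Fundamental identity for Z: for every boundedly finite Borel measure M, every bounded Borel set B, and every Borel set A ⊆ B of diameter less than one, Z(B, M) = Z(B \ A, M) − ∫_A Z(B \ U(y), M) M(dy), where U(y) is the open ball of radius 1 around y. -/
open MeasureTheory Metric

/-- Indicator of 1-hard-core tuples: `1` iff all pairs of distinct coordinates are at
distance at least one. (`h_0 = 1` by the empty quantification.) -/
noncomputable def hardCore {X : Type*} [MetricSpace X] (n : ℕ) (x : Fin n → X) : ℝ :=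
  if ∀ i j : Fin n, i ≠ j → 1 ≤ dist (x i) (x j) then 1 else 0

/-- The generating function `Z(B, M)` of weighted 1-hard-core configurations. -/
noncomputable def genZ {X : Type*} [MetricSpace X] [MeasurableSpace X]
    (B : Set X) (M : Measure X) : ℝ :=
  ∑' n : ℕ, ((-1 : ℝ) ^ n / n.factorial) *
    ∫ x in (Set.univ.pi fun _ : Fin n => B), hardCore n x ∂(Measure.pi fun _ : Fin n => M)

/-- The unit partition number `κ(B)`: the least `k` such that `B` is a disjoint union of
`k` Borel sets of diameter less than one (`⊤` if there is no such finite partition). -/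
noncomputable def kappa {X : Type*} [MetricSpace X] [MeasurableSpace X] (B : Set X) : ℕ∞ :=
  sInf {k : ℕ∞ | ∃ m : ℕ, k = (m : ℕ∞) ∧ ∃ A : Fin m → Set X,
    (∀ i, MeasurableSet (A i)) ∧ (∀ i, EMetric.diam (A i) < 1) ∧
    Pairwise (Function.onFun Disjoint A) ∧ B = ⋃ i, A i}

lemma integral_pi_eq_integral_insertNth {X : Type*} [MeasurableSpace X] (μ : Measure X)
    [IsFiniteMeasure μ] {n : ℕ} (i : Fin (n + 1))
    {g : (Fin (n + 1) → X) → ℝ} (hg : Integrable g (Measure.pi fun _ => μ)) :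
    ∫ x, g x ∂(Measure.pi fun _ => μ) =
      ∫ y, ∫ x : Fin n → X, g (i.insertNth y x) ∂(Measure.pi fun _ => μ) ∂μ := by
  have hmp := (measurePreserving_piFinSuccAbove (fun _ : Fin (n + 1) => μ) i).symm
  rw [← hmp.integral_comp', integral_prod]
  · rfl
  · exact (hmp.integrable_comp_emb (MeasurableEquiv.measurableEmbedding _)).2 hg

lemma measurableSet_univ_pi_const {X : Type*} [MeasurableSpace X] (n : ℕ) {s : Set X}
    (hs : MeasurableSet s) :
    MeasurableSet (Set.univ.pi fun _ : Fin n => s) :=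
  .univ_pi fun _ => hs

section HardCore

variable {X : Type*} [MetricSpace X]

lemma hardCore_nonneg (n : ℕ) (x : Fin n → X) : 0 ≤ hardCore n x := by
  unfold hardCore; split_ifs <;> norm_num

lemma hardCore_le_one (n : ℕ) (x : Fin n → X) : hardCore n x ≤ 1 := by
  unfold hardCore; split_ifs <;> norm_num

lemma norm_hardCore_le_one (n : ℕ) (x : Fin n → X) : ‖hardCore n x‖ ≤ 1 := by
  rw [Real.norm_of_nonneg (hardCore_nonneg n x)]
  exact hardCore_le_one n x

lemma hardCore_insertNth {n : ℕ} (i : Fin (n + 1)) (y : X) (x : Fin n → X) :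
    hardCore (n + 1) (i.insertNth y x : Fin (n + 1) → X) =
      (Set.univ.pi fun _ : Fin n => (ball y 1)ᶜ).indicator (hardCore n) x := by
  classical
  have h : (∀ j k : Fin (n + 1), j ≠ k → 1 ≤ dist ((i.insertNth y x : Fin (n + 1) → X) j)
        ((i.insertNth y x : Fin (n + 1) → X) k)) ↔
      (x ∈ Set.univ.pi fun _ : Fin n => (ball y 1)ᶜ) ∧
        ∀ j k : Fin n, j ≠ k → 1 ≤ dist (x j) (x k) := by
    simp only [Fin.forall_iff_succAbove i, Fin.insertNth_apply_same,
      Fin.insertNth_apply_succAbove, ne_eq, not_true_eq_false, false_implies, true_and,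
      Fin.succAbove_right_inj, Fin.succAbove_ne, (Fin.succAbove_ne i _).symm,
      not_false_eq_true, true_implies, Set.mem_pi, Set.mem_univ, Set.mem_compl_iff,
      mem_ball, not_lt, forall_and, dist_comm y, and_self_left]
  by_cases hx : x ∈ Set.univ.pi fun _ : Fin n => (ball y 1)ᶜ
  · rw [Set.indicator_of_mem hx]
    simp only [hardCore, h, hx, true_and]
  · rw [Set.indicator_of_notMem hx]
    simp only [hardCore, h, hx, false_and, if_false]

/-- A hard-core tuple visits a set of diameter less than one at most once. -/
lemma hardCore_eq_add_sum {n : ℕ} {A : Set X} (hAd : ediam A < 1) (x : Fin n → X) :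
    hardCore n x = (Set.univ.pi fun _ : Fin n => Aᶜ).indicator (hardCore n) x +
      ∑ i, ((fun z : Fin n → X => z i) ⁻¹' A).indicator (hardCore n) x := by
  classical
  by_cases hx : ∀ i j : Fin n, i ≠ j → 1 ≤ dist (x i) (x j)
  · by_cases hA : ∃ i, x i ∈ A
    · obtain ⟨i, hi⟩ := hA
      rw [Set.indicator_of_notMem (fun h => (Set.mem_univ_pi.1 h i : x i ∉ A) hi),
        Finset.sum_eq_single_of_mem i (Finset.mem_univ i), Set.indicator_of_mem (by exact hi),
        zero_add]
      intro j _ hji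
      refine Set.indicator_of_notMem (fun hj => ?_) _
      have h1 : edist (x j) (x i) < 1 :=
        (edist_le_ediam_of_mem (show x j ∈ A from hj) hi).trans_lt hAd
      rw [edist_dist, ENNReal.ofReal_lt_one] at h1
      exact (hx j i hji).not_gt h1
    · push Not at hA
      rw [Set.indicator_of_mem (Set.mem_univ_pi.2 hA), Finset.sum_eq_zero, add_zero]
      exact fun i _ => Set.indicator_of_notMem (by exact hA i) _
  · have h0 : hardCore n x = 0 := if_neg hx
    simp [Set.indicator_apply, h0]

lemma norm_setIntegral_hardCore_le [MeasurableSpace X] (μ : Measure X) [IsFiniteMeasure μ]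
    (n : ℕ) (s : Set (Fin n → X)) :
    ‖∫ x in s, hardCore n x ∂(Measure.pi fun _ : Fin n => μ)‖ ≤ μ.real Set.univ ^ n := by
  refine (norm_setIntegral_le_of_norm_le_const (measure_lt_top _ _)
    fun x _ => norm_hardCore_le_one n x).trans ?_
  rw [one_mul]
  refine (measureReal_mono (Set.subset_univ s)).trans_eq ?_
  simp [measureReal_def, Measure.pi_univ]

lemma norm_genZ_term_le [MeasurableSpace X] (μ : Measure X) [IsFiniteMeasure μ]
    (n : ℕ) (s : Set (Fin n → X)) :
    ‖((-1 : ℝ) ^ n / n.factorial) *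
      ∫ x in s, hardCore n x ∂(Measure.pi fun _ : Fin n => μ)‖ ≤
      μ.real Set.univ ^ n / n.factorial := by
  rw [norm_mul, norm_div, norm_pow, norm_neg, norm_one, one_pow,
    Real.norm_of_nonneg (Nat.cast_nonneg _), one_div_mul_eq_div]
  gcongr
  exact norm_setIntegral_hardCore_le μ n s

lemma hasSum_genZ [MeasurableSpace X] (μ : Measure X) [IsFiniteMeasure μ]
    (B : Set X) :
    HasSum (fun n : ℕ => ((-1 : ℝ) ^ n / n.factorial) *
      ∫ x in (Set.univ.pi fun _ : Fin n => B), hardCore n x ∂(Measure.pi fun _ : Fin n => μ))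
      (genZ B μ) :=
  (Summable.of_norm_bounded (Real.summable_pow_div_factorial _)
    fun n => norm_genZ_term_le μ n _).hasSum

variable [SecondCountableTopology X] [MeasurableSpace X] [BorelSpace X]

lemma measurable_hardCore (n : ℕ) : Measurable (hardCore n : (Fin n → X) → ℝ) := by
  refine Measurable.ite ?_ measurable_const measurable_const
  refine IsClosed.measurableSet ?_
  simp only [Set.ofPred_forall]
  exact isClosed_iInter fun i => isClosed_iInter fun j => isClosed_iInter fun _ =>
    isClosed_le continuous_const (by fun_prop)

lemma integrable_hardCore (n : ℕ) (μ : Measure (Fin n → X)) [IsFiniteMeasure μ] :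
    Integrable (hardCore n) μ :=
  .of_bound (measurable_hardCore n).aestronglyMeasurable 1
    (.of_forall (norm_hardCore_le_one n))

variable (μ : Measure X) [IsFiniteMeasure μ]

lemma stronglyMeasurable_setIntegral_hardCore (n : ℕ) :
    StronglyMeasurable fun y : X =>
      ∫ x in (Set.univ.pi fun _ : Fin n => (ball y 1)ᶜ), hardCore n x
        ∂(Measure.pi fun _ : Fin n => μ) := by
  have h : Measurable fun p : X × (Fin n → X) =>
      hardCore (n + 1) ((0 : Fin (n + 1)).insertNth p.1 p.2 : Fin (n + 1) → X) :=
    (measurable_hardCore (n + 1)).comp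
      (MeasurableEquiv.piFinSuccAbove (fun _ : Fin (n + 1) => X) 0).symm.measurable
  have h2 := h.stronglyMeasurable.integral_prod_right' (ν := Measure.pi fun _ : Fin n => μ)
  convert h2 using 2 with y
  rw [← integral_indicator (measurableSet_univ_pi_const n measurableSet_ball.compl)]
  exact integral_congr_ae (.of_forall fun x => (hardCore_insertNth 0 y x).symm)

lemma integral_hardCore_succ {A : Set X} (hAm : MeasurableSet A) (hAd : ediam A < 1)
    (n : ℕ) :
    ∫ x, hardCore (n + 1) x ∂(Measure.pi fun _ : Fin (n + 1) => μ) =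
      ∫ x in (Set.univ.pi fun _ : Fin (n + 1) => Aᶜ), hardCore (n + 1) x
        ∂(Measure.pi fun _ : Fin (n + 1) => μ) +
      (n + 1) * ∫ y in A, ∫ x in (Set.univ.pi fun _ : Fin n => (ball y 1)ᶜ), hardCore n x
        ∂(Measure.pi fun _ : Fin n => μ) ∂μ := by
  have hint := integrable_hardCore (n + 1) (Measure.pi fun _ : Fin (n + 1) => μ)
  have hmeas (i : Fin (n + 1)) : MeasurableSet ((fun z : Fin (n + 1) → X => z i) ⁻¹' A) :=
    measurable_pi_apply i hAm
  have hterm (i : Fin (n + 1)) :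
      ∫ x, ((fun z : Fin (n + 1) → X => z i) ⁻¹' A).indicator (hardCore (n + 1)) x
        ∂(Measure.pi fun _ : Fin (n + 1) => μ) =
      ∫ y in A, ∫ x in (Set.univ.pi fun _ : Fin n => (ball y 1)ᶜ), hardCore n x
        ∂(Measure.pi fun _ : Fin n => μ) ∂μ := by
    rw [integral_pi_eq_integral_insertNth μ i (hint.indicator (hmeas i)),
      ← integral_indicator hAm]
    refine integral_congr_ae (.of_forall fun y => ?_)
    by_cases hy : y ∈ A
    · simp [hy, hardCore_insertNth,
        ← integral_indicator (measurableSet_univ_pi_const n (measurableSet_ball (x := y)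
          (ε := 1)).compl)]
    · simp [hy]
  have hC := measurableSet_univ_pi_const (n + 1) hAm.compl
  rw [integral_congr_ae (.of_forall (hardCore_eq_add_sum hAd)),
    integral_add (hint.indicator hC) (integrable_finsetSum _ fun i _ => hint.indicator (hmeas i)),
    integral_finsetSum _ fun i _ => hint.indicator (hmeas i), integral_indicator hC]
  simp [hterm]

lemma genZ_univ_eq {A : Set X} (hAm : MeasurableSet A) (hAd : ediam A < 1) :
    genZ Set.univ μ = genZ Aᶜ μ - ∫ y in A, genZ (ball y 1)ᶜ μ ∂μ := by
  have hI := hasSum_integral_of_dominated_convergence (μ := μ.restrict A)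
    (F := fun n y => ((-1 : ℝ) ^ n / n.factorial) *
      ∫ x in (Set.univ.pi fun _ : Fin n => (ball y 1)ᶜ), hardCore n x
        ∂(Measure.pi fun _ : Fin n => μ))
    (f := fun y => genZ (ball y 1)ᶜ μ)
    (fun n _ => μ.real Set.univ ^ n / n.factorial)
    (fun n => ((stronglyMeasurable_setIntegral_hardCore μ n).const_mul _).aestronglyMeasurable)
    (fun n => .of_forall fun y => norm_genZ_term_le μ n _)
    (.of_forall fun _ => Real.summable_pow_div_factorial _)
    (integrable_const _)
    (.of_forall fun y => hasSum_genZ μ (ball y 1)ᶜ)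
  have hd := (hasSum_nat_add_iff' 1).2 ((hasSum_genZ μ Set.univ).sub (hasSum_genZ μ Aᶜ))
  have h0 : genZ Set.univ μ - genZ Aᶜ μ = -∫ y in A, genZ (ball y 1)ᶜ μ ∂μ := by
    refine HasSum.unique ?_ hI.neg
    convert hd using 1
    · funext n
      rw [← mul_sub, Set.pi_univ, Measure.restrict_univ, integral_hardCore_succ μ hAm hAd n,
        add_sub_cancel_left, integral_const_mul, Nat.factorial_succ]
      push_cast
      field_simp
      ring
    · have hpi : (Set.univ.pi fun _ : Fin 0 => Aᶜ) = Set.univ :=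
        Set.eq_univ_of_forall fun x i => i.elim0
      simp [hpi]
  linarith

end HardCore

lemma sigmaFinite_of_isBounded_lt_top {X : Type*} [MetricSpace X] [MeasurableSpace X]
    (M : Measure X) (hM : ∀ s : Set X, Bornology.IsBounded s → M s < ⊤) : SigmaFinite M := by
  rcases isEmpty_or_nonempty X with h | ⟨⟨x⟩⟩
  · rw [Measure.eq_zero_of_isEmpty M]
    infer_instance
  · exact ⟨⟨⟨fun n : ℕ => ball x n, fun _ => trivial, fun _ => hM _ isBounded_ball,
      iUnion_ball_nat x⟩⟩⟩

lemma genZ_restrict {X : Type*} [MetricSpace X] [MeasurableSpace X]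
    (M : Measure X) [SigmaFinite M] {B C : Set X} (hC : MeasurableSet C) :
    genZ C (M.restrict B) = genZ (B ∩ C) M := by
  unfold genZ
  congr 1 with n
  rw [Measure.restrict_pi_pi, Measure.restrict_pi_pi, Measure.restrict_restrict hC,
    Set.inter_comm]

/-- Fundamental identity: for a bounded Borel set `B` and a Borel subset `A ⊆ B` of
diameter less than one, `Z(B, M) = Z(B \ A, M) − ∫_A Z(B \ U(y), M) M(dy)`. -/
theorem stmt2 {X : Type*} [MetricSpace X] [CompleteSpace X]
    [TopologicalSpace.SeparableSpace X] [MeasurableSpace X] [BorelSpace X]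
    (M : Measure X) (hM : ∀ s : Set X, Bornology.IsBounded s → M s < ⊤)
    (B : Set X) (hBm : MeasurableSet B) (hBb : Bornology.IsBounded B)
    (A : Set X) (hAm : MeasurableSet A) (hAB : A ⊆ B) (hAd : EMetric.diam A < 1) :
    genZ B M = genZ (B \ A) M - ∫ y in A, genZ (B \ Metric.ball y 1) M ∂M := by
  have : SecondCountableTopology X := UniformSpace.secondCountable_of_separable X
  have : SigmaFinite M := sigmaFinite_of_isBounded_lt_top M hM
  have : IsFiniteMeasure (M.restrict B) := ⟨by simpa using hM B hBb⟩
  have h := genZ_univ_eq (M.restrict B) hAm hAd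
  simpa only [genZ_restrict M MeasurableSet.univ, genZ_restrict M hAm.compl,
    genZ_restrict M measurableSet_ball.compl, Set.inter_univ, ← Set.sdiff_eq,
    Measure.restrict_restrict hAm, Set.inter_eq_left.2 hAB] using h
end

section
/- For every bounded Borel set B and every boundedly finite Borel measure M, the function f_B : [0, ∞) → ℝ, λ ↦ Z(B, λM), is continuous; moreover, for every ε with |ε| < 1 and ε ≥ −1, |Z(B, (1+ε)M) − Z(B, M)| ≤ |ε| · exp(2 M(B)). -/
open MeasureTheory Metric

theorem MeasureTheory.Measure.pi_smul_fin {X : Type*} [MeasurableSpace X] (μ : Measure X)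
    [IsFiniteMeasure μ] (l : ℝ) (n : ℕ) :
    (Measure.pi fun _ : Fin n => ENNReal.ofReal l • μ) =
      ENNReal.ofReal l ^ n • Measure.pi fun _ : Fin n => μ := by
  have : IsFiniteMeasure (ENNReal.ofReal l • μ) := Measure.smul_finite μ ENNReal.ofReal_ne_top
  refine Measure.pi_eq fun s _ => ?_
  simp [Measure.pi_pi, Finset.prod_mul_distrib]

theorem genZ_smul_eq_tsum {X : Type*} [MetricSpace X] [MeasurableSpace X] (M : Measure X)
    [SigmaFinite M] {B : Set X} (hB : M B < ⊤) {l : ℝ} (hl : 0 ≤ l) :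
    genZ B (ENNReal.ofReal l • M) = ∑' n : ℕ, ((-1 : ℝ) ^ n / n.factorial) *
      (l ^ n * ∫ x, hardCore n x ∂(Measure.pi fun _ : Fin n => M.restrict B)) := by
  have : SigmaFinite (ENNReal.ofReal l • M) :=
    SMul.sigmaFinite (μ := M) (Real.toNNReal l)
  have : IsFiniteMeasure (M.restrict B) := ⟨by simpa using hB⟩
  refine tsum_congr fun n => ?_
  rw [Measure.restrict_pi_pi]
  simp only [Measure.restrict_smul]
  rw [Measure.pi_smul_fin, integral_smul_measure]
  simp [ENNReal.toReal_ofReal hl]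

theorem abs_integral_hardCore_le {X : Type*} [MetricSpace X] [MeasurableSpace X] (μ : Measure X)
    [IsFiniteMeasure μ] (n : ℕ) :
    |∫ x, hardCore n x ∂(Measure.pi fun _ : Fin n => μ)| ≤ (μ Set.univ).toReal ^ n := by
  have h := norm_integral_le_of_norm_le_const (μ := Measure.pi fun _ : Fin n => μ)
    (f := hardCore n) (C := 1) (.of_forall fun x => by unfold hardCore; split_ifs <;> simp)
  simpa [measureReal_def, Measure.pi_univ] using h

theorem abs_one_add_pow_sub_one_le {ε : ℝ} (hε : |ε| ≤ 1) (n : ℕ) :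
    |(1 + ε) ^ n - 1| ≤ |ε| * (2 ^ n - 1) := by
  induction n with
  | zero => simp
  | succ n ih =>
    have h2 : |1 + ε| ≤ 2 := by
      rw [abs_le] at hε ⊢
      constructor <;> linarith
    calc |(1 + ε) ^ (n + 1) - 1| = |(1 + ε) * ((1 + ε) ^ n - 1) + ε| := by ring_nf
      _ ≤ |1 + ε| * |(1 + ε) ^ n - 1| + |ε| := by
        rw [← abs_mul]
        exact abs_add_le _ _
      _ ≤ 2 * (|ε| * (2 ^ n - 1)) + |ε| := by gcongr
      _ = |ε| * (2 ^ (n + 1) - 1) := by ring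

theorem abs_alternating_term_le {a : ℕ → ℝ} {m : ℝ} (ha : ∀ n, |a n| ≤ m ^ n) {R t : ℝ}
    {n : ℕ} (ht : |t| ≤ R ^ n) :
    |((-1 : ℝ) ^ n / n.factorial) * (t * a n)| ≤ (R * m) ^ n / n.factorial := by
  have h : |t| * |a n| ≤ R ^ n * m ^ n :=
    mul_le_mul ht (ha n) (abs_nonneg _) ((abs_nonneg _).trans ht)
  rw [abs_mul, abs_mul, abs_div, abs_pow, abs_neg, abs_one, one_pow, Nat.abs_cast, mul_pow,
    div_mul_eq_mul_div, one_mul]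
  gcongr

/-- The function `λ ↦ Z(B, λM)` is continuous on `[0, ∞)`; moreover for `ε ∈ [-1, 1)`
with `|ε| < 1`, `|Z(B, (1+ε)M) − Z(B, M)| ≤ |ε|·exp(2 M(B))`. -/
theorem stmt3 {X : Type*} [MetricSpace X] [CompleteSpace X]
    [TopologicalSpace.SeparableSpace X] [MeasurableSpace X] [BorelSpace X]
    (M : Measure X) (hM : ∀ s : Set X, Bornology.IsBounded s → M s < ⊤)
    (B : Set X) (hBm : MeasurableSet B) (hBb : Bornology.IsBounded B) :
    ContinuousOn (fun l : ℝ => genZ B (ENNReal.ofReal l • M)) (Set.Ici 0) ∧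
    ∀ ε : ℝ, |ε| < 1 → -1 ≤ ε →
      |genZ B (ENNReal.ofReal (1 + ε) • M) - genZ B M| ≤
        |ε| * Real.exp (2 * (M B).toReal) := by
  have : SigmaFinite M := by
    have : IsLocallyFiniteMeasure M :=
      ⟨fun x => ⟨ball x 1, ball_mem_nhds x one_pos, hM _ isBounded_ball⟩⟩
    have : SecondCountableTopology X := UniformSpace.secondCountable_of_separable X
    infer_instance
  have hB := hM B hBb
  have : IsFiniteMeasure (M.restrict B) := ⟨by simpa using hB⟩
  set m := (M B).toReal with hm
  have hZ := fun l (hl : (0 : ℝ) ≤ l) => genZ_smul_eq_tsum M hB hl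
  have ha := abs_integral_hardCore_le (M.restrict B)
  simp only [Measure.restrict_apply_univ, ← hm] at ha
  set a : ℕ → ℝ := fun n => ∫ x, hardCore n x ∂(Measure.pi fun _ : Fin n => M.restrict B)
  constructor
  · refine ContinuousOn.congr (f := fun l : ℝ =>
      ∑' n : ℕ, ((-1 : ℝ) ^ n / n.factorial) * (l ^ n * a n)) ?_ fun l hl => hZ l hl
    refine Continuous.continuousOn (continuous_iff_continuousAt.2 fun x => ?_)
    refine ContinuousOn.continuousAt (s := ball 0 (|x| + 1)) ?_
      (isOpen_ball.mem_nhds (by simp))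
    refine continuousOn_tsum (fun n => by fun_prop)
      (Real.summable_pow_div_factorial ((|x| + 1) * m)) fun n l hl => ?_
    refine abs_alternating_term_le ha ?_
    rw [abs_pow]
    gcongr
    simpa using (mem_ball_zero_iff.1 hl).le
  · intro ε hε hε'
    have h1 : genZ B M = ∑' n : ℕ, ((-1 : ℝ) ^ n / n.factorial) * a n := by
      simpa using hZ 1 zero_le_one
    have hs : ∀ l : ℝ, Summable fun n : ℕ =>
        ((-1 : ℝ) ^ n / n.factorial) * (l ^ n * a n) := fun l =>
      .of_norm_bounded (Real.summable_pow_div_factorial (|l| * m)) fun n =>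
        abs_alternating_term_le ha (abs_pow l n).le
    have hs1 := hs 1
    simp only [one_pow, one_mul] at hs1
    rw [h1, hZ (1 + ε) (by linarith), ← (hs _).tsum_sub hs1]
    have he : HasSum (fun n : ℕ => |ε| * ((2 * m) ^ n / n.factorial))
        (|ε| * Real.exp (2 * m)) := by
      rw [Real.exp_eq_exp_ℝ]
      exact (NormedSpace.expSeries_div_hasSum_exp (2 * m)).mul_left _
    rw [← Real.norm_eq_abs]
    refine tsum_of_norm_bounded he fun n => ?_
    have hp : |(1 + ε) ^ n - 1| ≤ |ε| * 2 ^ n :=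
      (abs_one_add_pow_sub_one_le hε.le n).trans (by gcongr; linarith)
    have hm0 : 0 ≤ m := ENNReal.toReal_nonneg
    calc ‖((-1 : ℝ) ^ n / n.factorial) * ((1 + ε) ^ n * a n) -
          ((-1 : ℝ) ^ n / n.factorial) * a n‖
        = |(1 + ε) ^ n - 1| * |a n| / n.factorial := by
          rw [← mul_sub, ← sub_one_mul, Real.norm_eq_abs, abs_mul, abs_mul, abs_div, abs_pow,
            abs_neg, abs_one, one_pow, Nat.abs_cast]
          ring
      _ ≤ |ε| * 2 ^ n * m ^ n / n.factorial := by
          gcongr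
          exact ha n
      _ = |ε| * ((2 * m) ^ n / n.factorial) := by rw [mul_pow]; ring
end

section
/- Let M be a boundedly finite Borel measure and let {A_i}_{i=1}^n be pairwise disjoint Borel sets of diameter less than one; for I ⊆ [n] write A_I := ⨆_{i∈I} A_i. Then for every natural number r ≥ κ(A_{[n]}), Σ_{I ⊆ [n], |I| ≤ r} (Δ({A_i}_{i∈I})Z(·, M))(A_{[n] \ I}) = 1. -/
open MeasureTheory Metric

/-- The set difference operator: `Δ(A)φ : B ↦ φ(B) − φ(B ∪ A)`. -/
noncomputable def deltaOp {α : Type*} (A : Set α) (φ : Set α → ℝ) : Set α → ℝ :=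
  fun B => φ B - φ (B ∪ A)

/-- Iterated application of set difference operators along a list of sets. -/
noncomputable def deltaIter {α : Type*} : List (Set α) → (Set α → ℝ) → Set α → ℝ
  | [], φ => φ
  | A :: l, φ => deltaOp A (deltaIter l φ)

open Finset in
theorem deltaIter_map_eq_sum_powerset {α ι : Type*} [DecidableEq ι] (A : ι → Set α)
    (φ : Set α → ℝ) (l : List ι) (hl : l.Nodup) (B : Set α) :
    deltaIter (l.map A) φ B =
      ∑ J ∈ l.toFinset.powerset, (-1 : ℝ) ^ #J * φ (B ∪ ⋃ i ∈ J, A i) := by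
  induction l generalizing B with
  | nil => simp [deltaIter]
  | cons a l ih =>
    obtain ⟨ha, hl⟩ := List.nodup_cons.1 hl
    have ha' : a ∉ l.toFinset := by simpa using ha
    rw [List.toFinset_cons, sum_powerset_insert ha', List.map_cons, deltaIter, deltaOp,
      ih hl, ih hl, sub_eq_add_neg, ← sum_neg_distrib]
    congr 1
    refine sum_congr rfl fun J hJ => ?_
    have haJ : a ∉ J := fun h => ha' (mem_powerset.1 hJ h)
    rw [card_insert_of_notMem haJ, set_biUnion_insert, Set.union_assoc, pow_succ]
    ring

open Finset in
theorem sum_sum_powerset_neg_one_pow_card_mul {ι : Type*} [Fintype ι] [DecidableEq ι]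
    (g : Finset ι → ℝ) :
    ∑ I : Finset ι, ∑ J ∈ I.powerset, (-1 : ℝ) ^ #J * g (Iᶜ ∪ J) = g ∅ := by
  have key : ∑ I : Finset ι, ∑ J ∈ I.powerset, (-1 : ℝ) ^ #J * g (Iᶜ ∪ J) =
      ∑ K : Finset ι, ∑ J ∈ K.powerset, (-1 : ℝ) ^ #J * g K := by
    rw [sum_sigma', sum_sigma']
    have hinv : ∀ p ∈ (univ : Finset (Finset ι)).sigma fun I => I.powerset,
        (⟨(p.1ᶜ ∪ p.2)ᶜ ∪ p.2, p.2⟩ : (_ : Finset ι) × Finset ι) = p := by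
      rintro ⟨I, J⟩ h
      have h : J ⊆ I := by simpa using h
      refine Sigma.ext ?_ HEq.rfl
      ext x
      have := @h x
      simp only [mem_union, mem_compl]
      tauto
    refine sum_nbij' (fun p => ⟨p.1ᶜ ∪ p.2, p.2⟩) (fun p => ⟨p.1ᶜ ∪ p.2, p.2⟩) ?_ ?_ hinv hinv ?_
    · exact fun p _ => mem_sigma.2 ⟨mem_univ _, mem_powerset.2 subset_union_right⟩
    · exact fun p _ => mem_sigma.2 ⟨mem_univ _, mem_powerset.2 subset_union_right⟩
    · intro p _; rfl
  have hsum (K : Finset ι) : ∑ J ∈ K.powerset, (-1 : ℝ) ^ #J = if K = ∅ then 1 else 0 := by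
    exact_mod_cast congrArg (Int.cast : ℤ → ℝ) (sum_powerset_neg_one_pow_card (x := K))
  simp_rw [key, ← sum_mul, hsum]
  simp

open Finset in
theorem sum_powerset_neg_one_pow_card_mul_eq_zero {ι : Type*} [DecidableEq ι]
    {I : Finset ι} {i : ι} (hi : i ∈ I) (f : Finset ι → ℝ) (hf : ∀ J, f (insert i J) = f J) :
    ∑ J ∈ I.powerset, (-1 : ℝ) ^ #J * f J = 0 := by
  rw [← insert_erase hi, sum_powerset_insert (notMem_erase i I), ← sum_add_distrib]
  refine sum_eq_zero fun J hJ => ?_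
  have hiJ : i ∉ J := fun h => notMem_erase i I (mem_powerset.1 hJ h)
  rw [card_insert_of_notMem hiJ, hf, pow_succ]
  ring

/-- A tuple with fewer entries than there are disjoint sets misses one of the sets. -/
theorem exists_forall_notMem_of_card_lt {X ι : Type*} {A : ι → Set X}
    (hA : Pairwise (Function.onFun Disjoint A)) {I : Finset ι} {m : ℕ} (hm : m < I.card)
    (x : Fin m → X) : ∃ i ∈ I, ∀ j, x j ∉ A i := by
  by_contra! h
  choose f hf using fun i : I => h i i.2
  have hinj : Function.Injective f := fun a b hab => Subtype.ext <| by
    by_contra hne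
    exact Set.disjoint_left.1 (hA hne) (hf a) (hab ▸ hf b)
  have := Fintype.card_le_of_injective f hinj
  simp at this
  omega

theorem exists_cover_of_kappa_le {X : Type*} [MetricSpace X] [MeasurableSpace X] {B : Set X}
    {r : ℕ} (h : kappa B ≤ r) :
    ∃ m ≤ r, ∃ C : Fin m → Set X, (∀ i, ediam (C i) < 1) ∧ B = ⋃ i, C i := by
  have hlt : kappa B < (r + 1 : ℕ) := h.trans_lt (by exact_mod_cast r.lt_succ_self)
  obtain ⟨_, ⟨m, rfl, C, -, hC, -, hB⟩, hm⟩ := sInf_lt_iff.1 hlt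
  exact ⟨m, Nat.lt_succ_iff.1 (by exact_mod_cast hm), C, hC, hB⟩

theorem hardCore_eq_zero_of_cover {X : Type*} [MetricSpace X] {k m : ℕ} {C : Fin k → Set X}
    (hC : ∀ i, ediam (C i) < 1) (hkm : k < m) (x : Fin m → X)
    (hx : ∀ j, x j ∈ ⋃ i, C i) : hardCore m x = 0 := by
  simp only [Set.mem_iUnion] at hx
  choose f hf using hx
  obtain ⟨a, b, hab, hfab⟩ := Fintype.exists_ne_map_eq_of_card_lt f (by simpa using hkm)
  refine if_neg fun h => ?_
  have hlt : edist (x a) (x b) < 1 :=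
    (Metric.edist_le_ediam_of_mem (hf a) (hfab ▸ hf b)).trans_lt (hC (f a))
  rw [edist_dist, ENNReal.ofReal_lt_one] at hlt
  exact absurd (h a b hab) (not_le.2 hlt)

theorem measurable_hardCore_s10 {X : Type*} [MetricSpace X] [SecondCountableTopology X]
    [MeasurableSpace X] [BorelSpace X] (m : ℕ) : Measurable (hardCore (X := X) m) := by
  refine Measurable.ite ?_ measurable_const measurable_const
  simp only [Set.ofPred_forall]
  refine MeasurableSet.iInter fun i => MeasurableSet.iInter fun j => MeasurableSet.iInter fun _ =>
    measurableSet_le measurable_const ?_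
  exact (measurable_pi_apply i).dist (measurable_pi_apply j)

theorem integrableOn_hardCore {X : Type*} [MetricSpace X] [SecondCountableTopology X]
    [MeasurableSpace X] [BorelSpace X] (M : Measure X) [SigmaFinite M] {B : Set X}
    (hB : M B < ⊤) (m : ℕ) :
    IntegrableOn (hardCore m) (Set.univ.pi fun _ : Fin m => B)
      (Measure.pi fun _ : Fin m => M) := by
  refine Measure.integrableOn_of_bounded (M := 1) ?_
    (measurable_hardCore_s10 m).aestronglyMeasurable (Filter.Eventually.of_forall fun x => ?_)
  · rw [Measure.pi_pi]
    exact ENNReal.prod_ne_top fun _ _ => hB.ne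
  · unfold hardCore
    split_ifs <;> simp

theorem genZ_eq_sum_of_cover {X : Type*} [MetricSpace X] [MeasurableSpace X] (M : Measure X)
    {k : ℕ} {C : Fin k → Set X} (hC : ∀ i, ediam (C i) < 1) {B : Set X}
    (hBm : MeasurableSet B) (hB : B ⊆ ⋃ i, C i) :
    genZ B M = ∑ m ∈ Finset.range (k + 1), ((-1 : ℝ) ^ m / m.factorial) *
      ∫ x, (Set.univ.pi fun _ : Fin m => B).indicator (hardCore m) x
        ∂(Measure.pi fun _ : Fin m => M) := by
  have hpi (m : ℕ) : MeasurableSet (Set.univ.pi fun _ : Fin m => B) :=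
    MeasurableSet.univ_pi fun _ => hBm
  simp_rw [integral_indicator (hpi _)]
  refine tsum_eq_sum fun m hm => ?_
  rw [setIntegral_eq_zero_of_forall_eq_zero, mul_zero]
  intro x hx
  refine hardCore_eq_zero_of_cover hC ?_ x fun j => hB (hx j (Set.mem_univ j))
  rw [Finset.mem_range, not_lt] at hm
  omega

open Finset in
/-- Iterated differences of `genZ` over more sets than needed to cover vanish. -/
theorem sum_powerset_neg_one_pow_card_mul_genZ_eq_zero {X : Type*} [MetricSpace X]
    [SecondCountableTopology X] [MeasurableSpace X] [BorelSpace X] (M : Measure X) [SigmaFinite M]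
    {ι : Type*} [DecidableEq ι] {A : ι → Set X} (hAm : ∀ i, MeasurableSet (A i))
    (hAf : ∀ i, M (A i) < ⊤) (hAdisj : Pairwise (Function.onFun Disjoint A))
    {k : ℕ} {C : Fin k → Set X} (hC : ∀ i, ediam (C i) < 1)
    (hAC : ∀ i, A i ⊆ ⋃ j, C j) {I : Finset ι} (hI : k < #I) (K : Finset ι) :
    ∑ J ∈ I.powerset, (-1 : ℝ) ^ #J * genZ (⋃ i ∈ K ∪ J, A i) M = 0 := by
  have hm (J : Finset ι) : MeasurableSet (⋃ i ∈ J, A i) :=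
    J.measurableSet_biUnion fun i _ => hAm i
  have hfin (J : Finset ι) : M (⋃ i ∈ J, A i) < ⊤ :=
    measure_biUnion_lt_top J.finite_toSet fun i _ => hAf i
  simp_rw [genZ_eq_sum_of_cover M hC (hm _) (Set.iUnion₂_subset fun i _ => hAC i), mul_sum]
  rw [sum_comm]
  refine sum_eq_zero fun m hmk => ?_
  simp_rw [mul_left_comm, ← mul_sum, ← integral_const_mul]
  rw [← integral_finsetSum, integral_eq_zero_of_ae, mul_zero]
  · refine Filter.Eventually.of_forall fun x => ?_
    obtain ⟨i, hi, hix⟩ := exists_forall_notMem_of_card_lt hAdisj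
      ((Nat.lt_succ_iff.1 (mem_range.1 hmk)).trans_lt hI) x
    refine sum_powerset_neg_one_pow_card_mul_eq_zero hi
      (fun J => (Set.univ.pi fun _ : Fin m => ⋃ i ∈ K ∪ J, A i).indicator (hardCore m) x) ?_
    intro J
    have : (x ∈ Set.univ.pi fun _ : Fin m => ⋃ i' ∈ K ∪ insert i J, A i') ↔
        x ∈ Set.univ.pi fun _ : Fin m => ⋃ i' ∈ K ∪ J, A i' := by
      simp [Set.mem_pi, union_insert, hix]
    by_cases h : x ∈ Set.univ.pi fun _ : Fin m => ⋃ i' ∈ K ∪ J, A i'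
    · rw [Set.indicator_of_mem h, Set.indicator_of_mem (this.2 h)]
    · rw [Set.indicator_of_notMem h, Set.indicator_of_notMem (mt this.1 h)]
  · intro J _
    exact ((integrableOn_hardCore M (hfin _) m).integrable_indicator
      (MeasurableSet.univ_pi fun _ => hm _)).const_mul _

theorem genZ_empty {X : Type*} [MetricSpace X] [MeasurableSpace X] (M : Measure X) :
    genZ ∅ M = 1 := by
  rw [genZ_eq_sum_of_cover M (C := (Fin.elim0 : Fin 0 → Set X)) (fun i => i.elim0)
    MeasurableSet.empty (Set.empty_subset _)]
  simp [hardCore, Measure.real, Measure.pi_empty_univ]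

/-- For pairwise disjoint Borel sets `A_1, …, A_n` of diameter less than one and any
`r ≥ κ(A_{[n]})`, `Σ_{I ⊆ [n], |I| ≤ r} (Δ({A_i}_{i ∈ I}) Z(·, M))(A_{[n] \ I}) = 1`. -/
theorem stmt10 {X : Type*} [MetricSpace X] [CompleteSpace X]
    [TopologicalSpace.SeparableSpace X] [MeasurableSpace X] [BorelSpace X]
    (M : Measure X) (hM : ∀ s : Set X, Bornology.IsBounded s → M s < ⊤)
    (n : ℕ) (A : Fin n → Set X)
    (hAm : ∀ i, MeasurableSet (A i)) (hAd : ∀ i, EMetric.diam (A i) < 1)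
    (hAdisj : Pairwise (Function.onFun Disjoint A))
    (r : ℕ) (hr : kappa (⋃ i, A i) ≤ (r : ℕ∞)) :
    ∑ I ∈ Finset.univ.filter (fun I : Finset (Fin n) => I.card ≤ r),
      deltaIter (I.toList.map A) (fun S => genZ S M)
        (⋃ i ∈ (Iᶜ : Finset (Fin n)), A i) = 1 := by
  classical
  have : IsLocallyFiniteMeasure M := ⟨fun x => ⟨ball x 1, ball_mem_nhds x one_pos,
    hM _ isBounded_ball⟩⟩
  have : SecondCountableTopology X := UniformSpace.secondCountable_of_separable X
  obtain ⟨k, hkr, C, hC, hAC⟩ := exists_cover_of_kappa_le hr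
  have hAf (i : Fin n) : M (A i) < ⊤ :=
    hM _ (Metric.isBounded_iff_ediam_ne_top.2 ((hAd i).trans ENNReal.one_lt_top).ne)
  have hΔ (I : Finset (Fin n)) :
      deltaIter (I.toList.map A) (fun S => genZ S M) (⋃ i ∈ (Iᶜ : Finset (Fin n)), A i) =
        ∑ J ∈ I.powerset, (-1 : ℝ) ^ J.card * genZ (⋃ i ∈ Iᶜ ∪ J, A i) M := by
    rw [deltaIter_map_eq_sum_powerset A _ _ I.nodup_toList, Finset.toList_toFinset]
    simp_rw [Finset.set_biUnion_union]
  simp_rw [hΔ]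
  rw [Finset.sum_filter_of_ne, sum_sum_powerset_neg_one_pow_card_mul fun K =>
    genZ (⋃ i ∈ K, A i) M]
  · simp [genZ_empty]
  · intro I _ hne
    by_contra! hI
    exact hne (sum_powerset_neg_one_pow_card_mul_genZ_eq_zero M hAm hAf hAdisj hC
      (fun i => hAC ▸ Set.subset_iUnion A i) (hkr.trans_lt hI) Iᶜ)
end

section
/- If M ∈ 𝓜^sh, A is a Borel set of diameter less than one, and B is a Borel set of finite unit partition number with Z(B, M) > 0 and A ∩ B = ∅, then z(A, B) := Z(A ∪ B, M)/Z(B, M) ≤ 1 − M(A). -/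
open MeasureTheory Metric

section HardCore

variable {X : Type*} [MetricSpace X]

/-- The set of `1`-hard-core `n`-tuples with all coordinates in `B`. -/
def hardCoreSet (n : ℕ) (B : Set X) : Set (Fin n → X) :=
  {x | (∀ i, x i ∈ B) ∧ ∀ i j, i ≠ j → 1 ≤ dist (x i) (x j)}

lemma hardCoreSet_mono {n : ℕ} {B C : Set X} (h : B ⊆ C) :
    hardCoreSet n B ⊆ hardCoreSet n C :=
  fun _ hx => ⟨fun i => h (hx.1 i), hx.2⟩

lemma dist_lt_one_of_ediam {A : Set X} (hA : Metric.ediam A < 1) {x y : X} (hx : x ∈ A)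
    (hy : y ∈ A) : dist x y < 1 := by
  have h : edist x y < 1 := (Metric.edist_le_ediam_of_mem hx hy).trans_lt hA
  rw [edist_dist] at h
  exact ENNReal.ofReal_lt_one.1 h

/-- Hard-core tuples have at most as many points as there are covering sets of diameter below
one. -/
lemma hardCoreSet_eq_empty_of_cover {ι : Type*} [Fintype ι] {P : ι → Set X}
    (hP : ∀ i, Metric.ediam (P i) < 1) {S : Set X} (hS : S ⊆ ⋃ i, P i) {n : ℕ}
    (hn : Fintype.card ι < n) : hardCoreSet n S = ∅ := by
  refine Set.eq_empty_of_forall_notMem fun x hx => ?_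
  choose f hf using fun i => Set.mem_iUnion.1 (hS (hx.1 i))
  obtain ⟨i, j, hij, hfij⟩ := Fintype.exists_ne_map_eq_of_card_lt f (by simpa using hn)
  have h := dist_lt_one_of_ediam (hP (f i)) (hf i) (hfij ▸ hf j)
  exact absurd (hx.2 i j hij) (not_le.2 h)

lemma isBounded_of_cover {ι : Type*} [Finite ι] {P : ι → Set X}
    (hP : ∀ i, Metric.ediam (P i) < 1) {S : Set X} (hS : S ⊆ ⋃ i, P i) :
    Bornology.IsBounded S :=
  (Bornology.isBounded_iUnion.2 fun i =>
    Metric.isBounded_iff_ediam_ne_top.2 ((hP i).trans ENNReal.one_lt_top).ne).subset hS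

/-- The hard-core `(n + 1)`-tuples whose `i`-th coordinate lies in `A` and whose other coordinates
lie in `B`. -/
def hardCoreAt (n : ℕ) (A B : Set X) (i : Fin (n + 1)) : Set (Fin (n + 1) → X) :=
  {x | x i ∈ A ∧ (∀ j, x (i.succAbove j) ∈ B) ∧ ∀ j k, j ≠ k → 1 ≤ dist (x j) (x k)}

lemma hardCoreSet_union {n : ℕ} {A B : Set X} (hA : Metric.ediam A < 1) :
    hardCoreSet (n + 1) (A ∪ B) = hardCoreSet (n + 1) B ∪ ⋃ i, hardCoreAt n A B i := by
  ext x
  constructor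
  · rintro ⟨hx, hd⟩
    by_cases h : ∀ i, x i ∈ B
    · exact Or.inl ⟨h, hd⟩
    · push Not at h
      obtain ⟨i, hi⟩ := h
      have hiA : x i ∈ A := (hx i).resolve_right hi
      refine Or.inr (Set.mem_iUnion.2 ⟨i, hiA, fun j => (hx _).resolve_left fun hj => ?_, hd⟩)
      exact absurd (hd i _ (Fin.ne_succAbove i j)) (not_le.2 (dist_lt_one_of_ediam hA hiA hj))
  · rintro (h | h)
    · exact hardCoreSet_mono Set.subset_union_right h
    · obtain ⟨i, hi, hj, hd⟩ := Set.mem_iUnion.1 h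
      refine ⟨fun k => ?_, hd⟩
      rcases Fin.eq_self_or_eq_succAbove i k with rfl | ⟨j, rfl⟩
      · exact Or.inl hi
      · exact Or.inr (hj j)

lemma disjoint_hardCoreSet_hardCoreAt {n : ℕ} {A B : Set X} (hAB : Disjoint A B) :
    Disjoint (hardCoreSet (n + 1) B) (⋃ i, hardCoreAt n A B i) := by
  refine Set.disjoint_iUnion_right.2 fun i => Set.disjoint_left.2 fun x hx hx' => ?_
  exact Set.disjoint_left.1 hAB hx'.1 (hx.1 i)

lemma pairwise_disjoint_hardCoreAt {n : ℕ} {A B : Set X} (hAB : Disjoint A B) :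
    Pairwise (Function.onFun Disjoint (hardCoreAt n A B)) := by
  refine fun i j hij => Set.disjoint_left.2 fun x hx hx' => ?_
  obtain ⟨k, rfl⟩ := Fin.exists_succAbove_eq hij
  exact Set.disjoint_left.1 hAB hx.1 (hx'.2.1 k)

lemma insertNth_mem_hardCoreAt {n : ℕ} {A B : Set X} {i : Fin (n + 1)} {a : X} {y : Fin n → X} :
    i.insertNth a y ∈ hardCoreAt n A B i ↔ a ∈ A ∧ y ∈ hardCoreSet n (B \ ball a 1) := by
  simp only [hardCoreAt, hardCoreSet, Set.mem_ofPred_eq, Fin.insertNth_apply_same,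
    Fin.insertNth_apply_succAbove, Set.mem_sdiff, mem_ball, not_lt]
  refine and_congr_right fun _ => ⟨fun ⟨hB, hd⟩ => ⟨fun j => ⟨hB j, ?_⟩, fun j k hjk => ?_⟩,
    fun ⟨hB, hd⟩ => ⟨fun j => (hB j).1, fun j k hjk => ?_⟩⟩
  · simpa using hd (i.succAbove j) i (Fin.succAbove_ne i j)
  · simpa using hd _ _ ((Fin.succAbove_right_injective (p := i)).ne hjk)
  · rcases eq_or_ne j i with rfl | hj
    · obtain ⟨k, rfl⟩ := Fin.exists_succAbove_eq hjk.symm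
      simpa [dist_comm] using (hB k).2
    · obtain ⟨j, rfl⟩ := Fin.exists_succAbove_eq hj
      rcases eq_or_ne k i with rfl | hk
      · simpa using (hB j).2
      · obtain ⟨k, rfl⟩ := Fin.exists_succAbove_eq hk
        simpa using hd j k fun h => hjk (h ▸ rfl)

variable [MeasurableSpace X]

lemma measure_hardCoreSet_lt_top (M : Measure X) [SigmaFinite M] {B : Set X} (hB : M B < ⊤)
    (n : ℕ) :
    (Measure.pi fun _ : Fin n => M) (hardCoreSet n B) < ⊤ := by
  have h : hardCoreSet n B ⊆ Set.univ.pi fun _ => B := fun x hx i _ => hx.1 i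
  refine (measure_mono h).trans_lt ?_
  rw [Measure.pi_pi]
  exact ENNReal.prod_lt_top fun _ _ => hB

lemma preimage_piFinSuccAbove_hardCoreAt (n : ℕ) (A B : Set X) (i : Fin (n + 1)) (a : X) :
    Prod.mk a ⁻¹' ((MeasurableEquiv.piFinSuccAbove (fun _ => X) i).symm ⁻¹' hardCoreAt n A B i) =
      {y | a ∈ A ∧ y ∈ hardCoreSet n (B \ ball a 1)} := by
  ext y
  exact insertNth_mem_hardCoreAt

variable [TopologicalSpace.SeparableSpace X] [BorelSpace X]

lemma measurableSet_pairwise_one_le_dist (n : ℕ) :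
    MeasurableSet {x : Fin n → X | ∀ i j, i ≠ j → 1 ≤ dist (x i) (x j)} := by
  have := UniformSpace.secondCountable_of_separable X
  simp only [Set.ofPred_forall]
  refine MeasurableSet.iInter fun i => MeasurableSet.iInter fun j => MeasurableSet.iInter fun _ => ?_
  exact measurableSet_le measurable_const ((measurable_pi_apply i).dist (measurable_pi_apply j))

lemma measurableSet_hardCoreAt {A B : Set X} (hA : MeasurableSet A) (hB : MeasurableSet B)
    (n : ℕ) (i : Fin (n + 1)) : MeasurableSet (hardCoreAt n A B i) := by
  refine (measurable_pi_apply i hA).inter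
    (MeasurableSet.inter (s₁ := {x | ∀ j, x (i.succAbove j) ∈ B}) ?_
      (measurableSet_pairwise_one_le_dist (n + 1)))
  simp only [Set.ofPred_forall]
  exact MeasurableSet.iInter fun j => measurable_pi_apply (i.succAbove j) hB

lemma setIntegral_hardCore (M : Measure X) (n : ℕ) (B : Set X) :
    ∫ x in (Set.univ.pi fun _ : Fin n => B), hardCore n x ∂(Measure.pi fun _ : Fin n => M) =
      (Measure.pi fun _ : Fin n => M).real (hardCoreSet n B) := by
  have h : hardCore n = Set.indicator
      {x : Fin n → X | ∀ i j, i ≠ j → 1 ≤ dist (x i) (x j)} 1 := by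
    ext x; simp [hardCore, Set.indicator_apply]
  rw [h, integral_indicator_one (measurableSet_pairwise_one_le_dist n),
    measureReal_restrict_apply (measurableSet_pairwise_one_le_dist n)]
  congr 1
  ext x
  simp [hardCoreSet, and_comm]

lemma genZ_eq_sum (M : Measure X) {B : Set X} {N : ℕ} (hN : ∀ n, N < n → hardCoreSet n B = ∅)
    {K : ℕ} (hK : N < K) :
    genZ B M = ∑ n ∈ Finset.range K, ((-1 : ℝ) ^ n / n.factorial) *
      (Measure.pi fun _ : Fin n => M).real (hardCoreSet n B) := by
  simp only [genZ, setIntegral_hardCore]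
  refine tsum_eq_sum fun n hn => ?_
  rw [hN n (by simp at hn; omega)]
  simp

lemma genZ_diff_ball_eq_sum (M : Measure X) {B : Set X} {N : ℕ}
    (hN : ∀ n, N < n → hardCoreSet n B = ∅) :
    (fun a => genZ (B \ ball a 1) M) = fun a => ∑ n ∈ Finset.range (N + 1),
      ((-1 : ℝ) ^ n / n.factorial) *
        (Measure.pi fun _ : Fin n => M).real (hardCoreSet n (B \ ball a 1)) :=
  funext fun _ => genZ_eq_sum M (fun n hn => Set.subset_eq_empty
    (hardCoreSet_mono Set.sdiff_subset) (hN n hn)) N.lt_succ_self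

variable (M : Measure X) [SigmaFinite M]

lemma measure_hardCoreAt {A B : Set X} (hA : MeasurableSet A) (hB : MeasurableSet B)
    (n : ℕ) (i : Fin (n + 1)) :
    (Measure.pi fun _ : Fin (n + 1) => M) (hardCoreAt n A B i) =
      ∫⁻ a in A, (Measure.pi fun _ : Fin n => M) (hardCoreSet n (B \ ball a 1)) ∂M := by
  have hm := (measurePreserving_piFinSuccAbove (fun _ : Fin (n + 1) => M) i).symm
  rw [← hm.measure_preimage (measurableSet_hardCoreAt hA hB n i).nullMeasurableSet,
    Measure.prod_apply (hm.measurable (measurableSet_hardCoreAt hA hB n i)),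
    ← lintegral_indicator hA]
  refine lintegral_congr fun a => ?_
  rw [preimage_piFinSuccAbove_hardCoreAt]
  by_cases ha : a ∈ A <;> simp [ha]

lemma measurable_measure_hardCoreSet_diff_ball {B : Set X} (hB : MeasurableSet B) (n : ℕ) :
    Measurable fun a =>
      (Measure.pi fun _ : Fin n => M) (hardCoreSet n (B \ ball a 1)) := by
  have h := measurable_measure_prodMk_left (ν := Measure.pi fun _ : Fin n => M)
    ((MeasurableEquiv.piFinSuccAbove (fun _ => X) 0).symm.measurable
      (measurableSet_hardCoreAt MeasurableSet.univ hB n 0))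
  simpa only [preimage_piFinSuccAbove_hardCoreAt, Set.mem_univ, true_and, Set.ofPred_mem_eq]
    using h

lemma integrableOn_measureReal_hardCoreSet {A B : Set X} (hA : M A < ⊤) (hB : MeasurableSet B)
    (hBf : M B < ⊤) (n : ℕ) :
    IntegrableOn (fun a =>
      (Measure.pi fun _ : Fin n => M).real (hardCoreSet n (B \ ball a 1))) A M := by
  refine Measure.integrableOn_of_bounded
    (M := (Measure.pi fun _ : Fin n => M).real (hardCoreSet n B)) hA.ne
    (measurable_measure_hardCoreSet_diff_ball M hB n).ennreal_toReal.aestronglyMeasurable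
    (Filter.Eventually.of_forall fun a => ?_)
  rw [Real.norm_of_nonneg measureReal_nonneg]
  exact measureReal_mono (hardCoreSet_mono Set.sdiff_subset)
    (measure_hardCoreSet_lt_top M hBf n).ne

lemma measureReal_hardCoreSet_union {A B : Set X} (hA : MeasurableSet A) (hB : MeasurableSet B)
    (hAd : Metric.ediam A < 1) (hAB : Disjoint A B) (hAf : M A < ⊤) (hBf : M B < ⊤) (n : ℕ) :
    (Measure.pi fun _ : Fin (n + 1) => M).real (hardCoreSet (n + 1) (A ∪ B)) =
      (Measure.pi fun _ : Fin (n + 1) => M).real (hardCoreSet (n + 1) B) +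
      (n + 1) * ∫ a in A, (Measure.pi fun _ : Fin n => M).real
        (hardCoreSet n (B \ ball a 1)) ∂M := by
  have hAt : ∀ i, (Measure.pi fun _ : Fin (n + 1) => M).real (hardCoreAt n A B i) =
      ∫ a in A, (Measure.pi fun _ : Fin n => M).real (hardCoreSet n (B \ ball a 1)) ∂M := by
    intro i
    simp only [Measure.real]
    rw [measure_hardCoreAt M hA hB, integral_toReal
      (measurable_measure_hardCoreSet_diff_ball M hB n).aemeasurable
      (Filter.Eventually.of_forall fun a => (measure_mono
        (hardCoreSet_mono Set.sdiff_subset)).trans_lt (measure_hardCoreSet_lt_top M hBf n))]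
  have hfin : (Measure.pi fun _ : Fin (n + 1) => M) (hardCoreSet (n + 1) (A ∪ B)) ≠ ⊤ :=
    (measure_hardCoreSet_lt_top M (measure_union_lt_top hAf hBf) (n + 1)).ne
  rw [hardCoreSet_union hAd] at hfin ⊢
  have hU : (Measure.pi fun _ : Fin (n + 1) => M) (⋃ i, hardCoreAt n A B i) ≠ ⊤ :=
    ne_top_of_le_ne_top hfin (measure_mono Set.subset_union_right)
  rw [measureReal_union (disjoint_hardCoreSet_hardCoreAt hAB)
    (MeasurableSet.iUnion fun i => measurableSet_hardCoreAt hA hB n i)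
    (ne_top_of_le_ne_top hfin (measure_mono Set.subset_union_left)) hU,
    measureReal_iUnion_fintype (pairwise_disjoint_hardCoreAt hAB)
    (fun i => measurableSet_hardCoreAt hA hB n i)
    (fun i => ne_top_of_le_ne_top hU (measure_mono (Set.subset_iUnion _ i)))]
  simp [hAt]

lemma integrableOn_genZ_diff_ball {A B : Set X} (hB : MeasurableSet B) (hAf : M A < ⊤)
    (hBf : M B < ⊤) {N : ℕ} (hN : ∀ n, N < n → hardCoreSet n B = ∅) :
    IntegrableOn (fun a => genZ (B \ ball a 1) M) A M := by
  rw [genZ_diff_ball_eq_sum M hN]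
  exact integrable_finsetSum _ fun n _ =>
    (integrableOn_measureReal_hardCoreSet M hAf hB hBf n).const_mul _

/-- The recursion for the generating function when adding a set of diameter below one. -/
lemma genZ_union {A B : Set X} (hA : MeasurableSet A) (hB : MeasurableSet B)
    (hAd : Metric.ediam A < 1) (hAB : Disjoint A B) (hAf : M A < ⊤) (hBf : M B < ⊤) {N : ℕ}
    (hN : ∀ n, N < n → hardCoreSet n (A ∪ B) = ∅) :
    genZ (A ∪ B) M = genZ B M - ∫ a in A, genZ (B \ ball a 1) M ∂M := by
  have hNB : ∀ n, N < n → hardCoreSet n B = ∅ := fun n hn =>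
    Set.subset_eq_empty (hardCoreSet_mono Set.subset_union_right) (hN n hn)
  rw [genZ_diff_ball_eq_sum M hNB, integral_finsetSum _ fun n _ =>
    (integrableOn_measureReal_hardCoreSet M hAf hB hBf n).const_mul _,
    genZ_eq_sum M hN (K := N + 1 + 1) (by omega), genZ_eq_sum M hNB (K := N + 1 + 1) (by omega),
    Finset.sum_range_succ', Finset.sum_range_succ' _ (N + 1)]
  have h0 : ∀ S : Set X, hardCoreSet 0 S = Set.univ := fun S => by
    ext x; simp [hardCoreSet]
  rw [h0, h0, add_sub_right_comm, ← Finset.sum_sub_distrib]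
  congr 1
  refine Finset.sum_congr rfl fun n _ => ?_
  rw [measureReal_hardCoreSet_union M hA hB hAd hAB hAf hBf, integral_const_mul,
    Nat.factorial_succ]
  have : (n.factorial : ℝ) ≠ 0 := by positivity
  push_cast
  field_simp
  ring

end HardCore

section Shearer

variable {X : Type*} [MetricSpace X] [TopologicalSpace.SeparableSpace X] [MeasurableSpace X]
  {M : Measure X}

lemma sigmaFinite_of_boundedly_finite (hM : ∀ s : Set X, Bornology.IsBounded s → M s < ⊤) :
    SigmaFinite M := by
  have := UniformSpace.secondCountable_of_separable X
  have : IsLocallyFiniteMeasure M :=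
    ⟨fun x => ⟨ball x 1, ball_mem_nhds x one_pos, hM _ isBounded_ball⟩⟩
  infer_instance

variable [BorelSpace X]

/-- In the Shearer regime, adding sets of diameter below one does not increase `genZ`. -/
lemma genZ_union_le (hM : ∀ s : Set X, Bornology.IsBounded s → M s < ⊤)
    (hsh : ∀ B : Set X, MeasurableSet B → Bornology.IsBounded B → 0 ≤ genZ B M)
    {A B : Set X} (hA : MeasurableSet A) (hB : MeasurableSet B) (hAd : Metric.ediam A < 1)
    (hbdd : Bornology.IsBounded (A ∪ B)) {N : ℕ}
    (hN : ∀ n, N < n → hardCoreSet n (A ∪ B) = ∅) :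
    genZ (A ∪ B) M ≤ genZ B M := by
  have := sigmaFinite_of_boundedly_finite hM
  have hBb := hbdd.subset Set.subset_union_right
  rw [← Set.sdiff_union_self] at hN ⊢
  rw [genZ_union M (hA.diff hB) hB ((Metric.ediam_mono Set.sdiff_subset).trans_lt hAd)
    Set.disjoint_sdiff_left
    (hM _ (hbdd.subset (Set.sdiff_subset.trans Set.subset_union_left))) (hM _ hBb) hN]
  exact sub_le_self _ (integral_nonneg fun a =>
    hsh _ (hB.diff measurableSet_ball) (hBb.subset Set.sdiff_subset))

lemma genZ_biUnion_union_le (hM : ∀ s : Set X, Bornology.IsBounded s → M s < ⊤)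
    (hsh : ∀ B : Set X, MeasurableSet B → Bornology.IsBounded B → 0 ≤ genZ B M)
    {ι : Type*} {P : ι → Set X} (hP : ∀ i, MeasurableSet (P i))
    (hPd : ∀ i, Metric.ediam (P i) < 1) {C D : Set X} (hC : MeasurableSet C) (hCD : C ⊆ D)
    (hPD : ∀ i, P i ⊆ D) (hD : Bornology.IsBounded D) {N : ℕ}
    (hN : ∀ n, N < n → hardCoreSet n D = ∅) (s : Finset ι) :
    genZ ((⋃ i ∈ s, P i) ∪ C) M ≤ genZ C M := by
  classical
  induction s using Finset.induction_on with
  | empty => simp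
  | insert i s _ ih =>
    have hsub : P i ∪ ((⋃ i ∈ s, P i) ∪ C) ⊆ D :=
      Set.union_subset (hPD i) (Set.union_subset (Set.iUnion₂_subset fun i _ => hPD i) hCD)
    rw [Finset.set_biUnion_insert, Set.union_assoc]
    exact (genZ_union_le hM hsh (hP i) ((s.measurableSet_biUnion fun i _ => hP i).union hC)
      (hPd i) (hD.subset hsub) fun n hn =>
        Set.subset_eq_empty (hardCoreSet_mono hsub) (hN n hn)).trans ih

/-- In the Shearer regime, `genZ` is antitone below a set with a finite unit partition. -/
lemma genZ_anti (hM : ∀ s : Set X, Bornology.IsBounded s → M s < ⊤)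
    (hsh : ∀ B : Set X, MeasurableSet B → Bornology.IsBounded B → 0 ≤ genZ B M)
    {ι : Type*} [Fintype ι] {P : ι → Set X} (hP : ∀ i, MeasurableSet (P i))
    (hPd : ∀ i, Metric.ediam (P i) < 1) {C : Set X} (hC : MeasurableSet C)
    (hCP : C ⊆ ⋃ i, P i) :
    genZ (⋃ i, P i) M ≤ genZ C M := by
  have h := genZ_biUnion_union_le hM hsh hP hPd hC hCP (Set.subset_iUnion P)
    (isBounded_of_cover hPd subset_rfl)
    (fun n hn => hardCoreSet_eq_empty_of_cover hPd subset_rfl hn) Finset.univ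
  simpa [Set.union_eq_self_of_subset_right hCP] using h

end Shearer

/-- If `M ∈ 𝓜^sh`, `A` is a Borel set of diameter less than one, `B` is a Borel set of
finite unit partition number with `Z(B, M) > 0` and `A ∩ B = ∅`, then
`z(A, B) = Z(A ∪ B, M)/Z(B, M) ≤ 1 − M(A)`. -/
theorem stmt16 {X : Type*} [MetricSpace X] [CompleteSpace X]
    [TopologicalSpace.SeparableSpace X] [MeasurableSpace X] [BorelSpace X]
    (M : Measure X) (hM : ∀ s : Set X, Bornology.IsBounded s → M s < ⊤)
    (hsh : ∀ B : Set X, MeasurableSet B → Bornology.IsBounded B → 0 ≤ genZ B M)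
    (A B : Set X) (hAm : MeasurableSet A) (hAd : EMetric.diam A < 1)
    (hBm : MeasurableSet B) (hBk : kappa B < ⊤)
    (hZB : 0 < genZ B M) (hAB : A ∩ B = ∅) :
    genZ (A ∪ B) M / genZ B M ≤ 1 - (M A).toReal := by
  have := sigmaFinite_of_boundedly_finite hM
  obtain ⟨_, ⟨m, rfl, P, hP, hPd, -, rfl⟩, -⟩ := sInf_lt_iff.1 hBk
  have hQd : ∀ i : Option (Fin m), Metric.ediam (i.elim A P) < 1 := by
    rintro (_ | i)
    exacts [hAd, hPd i]
  have hQ : A ∪ ⋃ i, P i ⊆ ⋃ i : Option (Fin m), i.elim A P := by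
    rw [Set.iUnion_option]; rfl
  have hN : ∀ n, Fintype.card (Option (Fin m)) < n → hardCoreSet n (A ∪ ⋃ i, P i) = ∅ :=
    fun n hn => hardCoreSet_eq_empty_of_cover hQd hQ hn
  have hbdd := isBounded_of_cover hQd hQ
  have hAf := hM _ (hbdd.subset Set.subset_union_left)
  have hBf := hM _ (hbdd.subset Set.subset_union_right)
  have hle : genZ (⋃ i, P i) M * M.real A ≤ ∫ a in A, genZ ((⋃ i, P i) \ ball a 1) M ∂M := by
    refine setIntegral_ge_of_const_le_real hAm hAf.ne (fun a _ =>
      genZ_anti hM hsh hP hPd (hBm.diff measurableSet_ball) Set.sdiff_subset)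
      (integrableOn_genZ_diff_ball M hBm hAf hBf fun n hn => Set.subset_eq_empty
        (hardCoreSet_mono Set.subset_union_right) (hN n hn))
  rw [div_le_iff₀ hZB, genZ_union M hAm hBm hAd (Set.disjoint_iff_inter_eq_empty.2 hAB) hAf hBf hN]
  rw [Measure.real] at hle
  linarith
end
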